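/- (Full-circuit Clifford decomposition of a parameterized quantum circuit.) Let N ≥ 1 and L ≥ 1. For each l = 1,…,L let P_l ∈ M_N(ℂ) be Hermitian with P_l² = 1, let C_l ∈ M_N(ℂ) be unitary, let θ_l ∈ ℝ, and set U_l(θ) = R_{P_l}(θ)·C_l. Then for every ρ ∈ M_N(ℂ), U_L(θ_L)⋯U_1(θ_1) ρ (U_L(θ_L)⋯U_1(θ_1))† = Σ_{(k_1,…,k_L) ∈ {0,1,2,3}^L} (Π_{l=1}^{L} a_{k_l}(θ_l)) · U_L(k_Lπ/2)⋯U_1(k_1π/2) ρ (U_L(k_Lπ/2)⋯U_1(k_1π/2))†, where a_k(θ) are the quasiprobability coefficients defined below. -/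

import Mathlib

open Matrix

/-- The rotation gate `R_P(θ) = cos(θ/2)·1 − i·sin(θ/2)·P` generated by a
Hermitian involution `P`. -/
noncomputable def rotGate {N : ℕ} (P : Matrix (Fin N) (Fin N) ℂ) (θ : ℝ) :
    Matrix (Fin N) (Fin N) ℂ :=
  (Real.cos (θ / 2) : ℂ) • (1 : Matrix (Fin N) (Fin N) ℂ) -
    (Complex.I * (Real.sin (θ / 2) : ℂ)) • P

/-- The quasiprobability coefficients `a_k(θ)` of the optimal Clifford
decomposition of a Pauli rotation. -/
noncomputable def qpCoeff (θ : ℝ) : Fin 4 → ℝ :=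
  ![|Real.cos θ| / (2 * (|Real.sin θ| + |Real.cos θ|)) + Real.cos θ / 2,
    |Real.sin θ| / (2 * (|Real.sin θ| + |Real.cos θ|)) + Real.sin θ / 2,
    |Real.cos θ| / (2 * (|Real.sin θ| + |Real.cos θ|)) - Real.cos θ / 2,
    |Real.sin θ| / (2 * (|Real.sin θ| + |Real.cos θ|)) - Real.sin θ / 2]

/-- Reversed ordered product `G_{L-1} ⋯ G_1 G_0` of a family of elements
(layer `0` applied first, i.e. rightmost). -/
def prodRev {M : Type*} [Monoid M] : (L : ℕ) → (Fin L → M) → M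
  | 0, _ => 1
  | L + 1, G => G (Fin.last L) * prodRev L (fun l => G l.castSucc)

theorem abs_sin_add_abs_cos_pos (θ : ℝ) : 0 < |Real.sin θ| + |Real.cos θ| := by
  by_contra! h
  have hs : |Real.sin θ| = 0 := by linarith [abs_nonneg (Real.sin θ), abs_nonneg (Real.cos θ)]
  have hc : |Real.cos θ| = 0 := by linarith [abs_nonneg (Real.sin θ), abs_nonneg (Real.cos θ)]
  have h1 := Real.sin_sq_add_cos_sq θ
  rw [abs_eq_zero.mp hs, abs_eq_zero.mp hc] at h1
  norm_num at h1

theorem sum_qpCoeff (θ : ℝ) : ∑ k, qpCoeff θ k = 1 := by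
  have h := (abs_sin_add_abs_cos_pos θ).ne'
  simp only [Fin.sum_univ_four, qpCoeff, Matrix.cons_val]
  field_simp
  ring

theorem cos_nat_mul_pi_div_two (k : Fin 4) :
    Real.cos ((k : ℕ) * Real.pi / 2) = (![1, 0, -1, 0] : Fin 4 → ℝ) k := by
  fin_cases k
  · simp
  · simp
  · simp
  · have h : (3 : ℝ) * Real.pi / 2 = Real.pi / 2 + Real.pi := by ring
    simp [h, Real.cos_add_pi]

theorem sin_nat_mul_pi_div_two (k : Fin 4) :
    Real.sin ((k : ℕ) * Real.pi / 2) = (![0, 1, 0, -1] : Fin 4 → ℝ) k := by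
  fin_cases k
  · simp
  · simp
  · simp
  · have h : (3 : ℝ) * Real.pi / 2 = Real.pi / 2 + Real.pi := by ring
    simp [h, Real.sin_add_pi]

theorem sum_qpCoeff_mul_cos (θ : ℝ) :
    ∑ k : Fin 4, qpCoeff θ k * Real.cos ((k : ℕ) * Real.pi / 2) = Real.cos θ := by
  simp only [cos_nat_mul_pi_div_two, Fin.sum_univ_four, qpCoeff, Matrix.cons_val]
  ring

theorem sum_qpCoeff_mul_sin (θ : ℝ) :
    ∑ k : Fin 4, qpCoeff θ k * Real.sin ((k : ℕ) * Real.pi / 2) = Real.sin θ := by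
  simp only [sin_nat_mul_pi_div_two, Fin.sum_univ_four, qpCoeff, Matrix.cons_val]
  ring

/-- Conjugation by a rotation gate is affine in `(cos θ, sin θ)`. -/
theorem rotGate_conj {N : ℕ} {P : Matrix (Fin N) (Fin N) ℂ} (hP : P.IsHermitian) (θ : ℝ)
    (X : Matrix (Fin N) (Fin N) ℂ) :
    rotGate P θ * X * (rotGate P θ)ᴴ =
      (1 / 2 : ℂ) • (X + P * X * P) + (Real.cos θ : ℂ) • ((1 / 2 : ℂ) • (X - P * X * P)) +
        (Real.sin θ : ℂ) • ((Complex.I / 2) • (X * P - P * X)) := by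
  obtain ⟨t, rfl⟩ : ∃ t, θ = 2 * t := ⟨θ / 2, by ring⟩
  have hI : Complex.I ^ 2 = -1 := Complex.I_sq
  have hcs := Complex.cos_sq_add_sin_sq (t : ℂ)
  have hstar : (rotGate P (2 * t))ᴴ =
      (Real.cos t : ℂ) • (1 : Matrix (Fin N) (Fin N) ℂ) +
        (Complex.I * (Real.sin t : ℂ)) • P := by
    simp [rotGate, Matrix.conjTranspose_sub, Matrix.conjTranspose_smul, hP.eq,
      -Complex.ofReal_cos, -Complex.ofReal_sin]
  rw [hstar, rotGate, mul_div_cancel_left₀ t two_ne_zero, Real.cos_two_mul, Real.sin_two_mul]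
  push_cast
  simp only [sub_mul, mul_add, smul_mul_assoc, mul_smul_comm, one_mul, mul_one]
  match_scalars <;>
    first
    | ring1
    | linear_combination hcs - Complex.sin t ^ 2 * hI

theorem rotGate_conj_eq_sum {N : ℕ} {P : Matrix (Fin N) (Fin N) ℂ} (hP : P.IsHermitian) (θ : ℝ)
    (X : Matrix (Fin N) (Fin N) ℂ) :
    rotGate P θ * X * (rotGate P θ)ᴴ =
      ∑ k : Fin 4, (qpCoeff θ k : ℂ) •
        (rotGate P ((k : ℕ) * Real.pi / 2) * X * (rotGate P ((k : ℕ) * Real.pi / 2))ᴴ) := by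
  simp only [rotGate_conj hP, smul_add _ (_ + _), smul_add _ ((1 / 2 : ℂ) • _),
    Finset.sum_add_distrib]
  simp only [smul_smul _ (Complex.ofReal _), ← Finset.sum_smul, ← Complex.ofReal_mul,
    ← Complex.ofReal_sum, sum_qpCoeff, sum_qpCoeff_mul_cos, sum_qpCoeff_mul_sin,
    Complex.ofReal_one, one_smul]

/-- If conjugation by each factor is a linear combination of conjugations, then conjugation by the
ordered product is the multilinear expansion over all tuples of choices. -/
theorem prodRev_conj_eq_sum {n κ : Type*} [Fintype n] [DecidableEq n] [Fintype κ] :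
    ∀ (L : ℕ) (U : Fin L → Matrix n n ℂ) (V : Fin L → κ → Matrix n n ℂ) (a : Fin L → κ → ℝ),
      (∀ l X, U l * X * (U l)ᴴ = ∑ k, (a l k : ℂ) • (V l k * X * (V l k)ᴴ)) →
      ∀ X, prodRev L U * X * (prodRev L U)ᴴ =
        ∑ k : Fin L → κ, ((∏ l, a l (k l) : ℝ) : ℂ) •
          (prodRev L (fun l => V l (k l)) * X * (prodRev L (fun l => V l (k l)))ᴴ)
  | 0, _, _, _, _, X => by simp [prodRev]
  | L + 1, U, V, a, h, X => by
    have ih := prodRev_conj_eq_sum L (fun l => U l.castSucc) (fun l => V l.castSucc)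
      (fun l => a l.castSucc) (fun l => h l.castSucc) X
    have hassoc (A B : Matrix n n ℂ) : A * B * X * (A * B)ᴴ = A * (B * X * Bᴴ) * Aᴴ := by
      simp only [Matrix.conjTranspose_mul, mul_assoc]
    rw [← Equiv.sum_comp (Fin.snocEquiv fun _ : Fin (L + 1) => κ), Fintype.sum_prod_type]
    simp only [prodRev, hassoc, h (Fin.last L), ih, Fin.snocEquiv, Equiv.coe_fn_mk,
      Fin.snoc_last, Fin.snoc_castSucc, Fin.prod_univ_castSucc, Matrix.mul_sum, Matrix.sum_mul,
      Finset.smul_sum, Matrix.mul_smul, Matrix.smul_mul, smul_smul, Complex.ofReal_mul]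
    exact Finset.sum_comm

/-- Full-circuit Clifford decomposition of a parameterized quantum circuit:
the channel of `U_L(θ_L)⋯U_1(θ_1)` with `U_l(θ) = R_{P_l}(θ)·C_l` is the
linear combination, over all tuples `(k_1,…,k_L) ∈ {0,1,2,3}^L`, of the
channels of `U_L(k_Lπ/2)⋯U_1(k_1π/2)` with coefficients
`∏_l a_{k_l}(θ_l)`. -/
theorem full_circuit_clifford_decomposition
    (N L : ℕ) (hN : 1 ≤ N) (hL : 1 ≤ L)
    (P : Fin L → Matrix (Fin N) (Fin N) ℂ)
    (hHerm : ∀ l, (P l).IsHermitian) (hP2 : ∀ l, P l * P l = 1)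
    (C : Fin L → Matrix (Fin N) (Fin N) ℂ)
    (hC : ∀ l, C l ∈ Matrix.unitaryGroup (Fin N) ℂ)
    (θ : Fin L → ℝ) (ρ : Matrix (Fin N) (Fin N) ℂ) :
    prodRev L (fun l => rotGate (P l) (θ l) * C l) * ρ *
        (prodRev L (fun l => rotGate (P l) (θ l) * C l))ᴴ =
      ∑ k : Fin L → Fin 4,
        ((∏ l, qpCoeff (θ l) (k l) : ℝ) : ℂ) •
          (prodRev L (fun l => rotGate (P l) ((k l : ℕ) * Real.pi / 2) * C l) * ρ *
            (prodRev L
              (fun l => rotGate (P l) ((k l : ℕ) * Real.pi / 2) * C l))ᴴ) := by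
  refine prodRev_conj_eq_sum L _ (fun l (k : Fin 4) => rotGate (P l) ((k : ℕ) * Real.pi / 2) * C l)
    (fun l => qpCoeff (θ l)) (fun l X => ?_) ρ
  have hassoc (A B : Matrix (Fin N) (Fin N) ℂ) : A * B * X * (A * B)ᴴ = A * (B * X * Bᴴ) * Aᴴ := by
    simp only [Matrix.conjTranspose_mul, mul_assoc]
  simp only [hassoc]
  exact rotGate_conj_eq_sum (hHerm l) (θ l) _
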